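/- For every fixed integer k ≥ 1, there exist a constant c > 0 and an integer N such that for all n ≥ N, taking d = n − ⌈(k+1)·ln n / ln ln n⌉, one has A(n,d) ≥ c·n^k. -/

import Mathlib

/-- The tree-distance between two spanning trees on `Fin n`:
`d(T₁,T₂) = n - 1 - |E₁ ∩ E₂|`. -/
noncomputable def treeDist {n : ℕ} (G H : SimpleGraph (Fin n)) : ℕ :=
  n - 1 - (G.edgeSet ∩ H.edgeSet).ncard

/-- An `(n,d)` tree-code: a finite set of (spanning) trees on `Fin n`
such that any two distinct members have tree-distance at least `d`. -/
def IsTreeCode (n d : ℕ) (C : Finset (SimpleGraph (Fin n))) : Prop :=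
  (∀ G ∈ C, G.IsTree) ∧ ∀ G ∈ C, ∀ H ∈ C, G ≠ H → d ≤ treeDist G H

/-- `A n d`: the maximum size of an `(n,d)` tree-code. -/
noncomputable def A (n d : ℕ) : ℕ :=
  sSup {m : ℕ | ∃ C : Finset (SimpleGraph (Fin n)), IsTreeCode n d C ∧ C.card = m}

/-- An `(n,d;i)` tree-code: an `(n,d)` tree-code all of whose trees contain
a common set of at least `i` edges. -/
def IsTreeCodeCommon (n d i : ℕ) (C : Finset (SimpleGraph (Fin n))) : Prop :=
  IsTreeCode n d C ∧
    ∃ E : Finset (Sym2 (Fin n)), i ≤ E.card ∧ ∀ G ∈ C, (E : Set (Sym2 (Fin n))) ⊆ G.edgeSet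

/-- `Acommon n d i`: the maximum size of an `(n,d;i)` tree-code. -/
noncomputable def Acommon (n d i : ℕ) : ℕ :=
  sSup {m : ℕ | ∃ C : Finset (SimpleGraph (Fin n)), IsTreeCodeCommon n d i C ∧ C.card = m}

/-- The graph joining every vertex `v ≠ r` to its parent `P v`. -/
def parentGraph {V : Type*} (P : V → V) (r : V) : SimpleGraph V :=
  SimpleGraph.fromEdgeSet ((fun v => s(v, P v)) '' {v | v ≠ r})

theorem edgeSet_parentGraph_subset {V : Type*} (P : V → V) (r : V) :
    (parentGraph P r).edgeSet ⊆ (fun v => s(v, P v)) '' {v | v ≠ r} := by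
  rw [parentGraph, SimpleGraph.edgeSet_fromEdgeSet]
  exact Set.sdiff_subset

theorem isTree_parentGraph {V : Type*} [Finite V] (P : V → V) (r : V) (rank : V → ℕ)
    (hrank : ∀ v, v ≠ r → rank (P v) < rank v) : (parentGraph P r).IsTree := by
  have hreach : ∀ m v, rank v ≤ m → (parentGraph P r).Reachable v r := by
    intro m
    induction m with
    | zero =>
      intro v hv
      by_cases h : v = r
      · rw [h]
      · have := hrank v h
        omega
    | succ m ih =>
      intro v hv
      by_cases h : v = r
      · rw [h]
      · have hlt := hrank v h
        have hadj : (parentGraph P r).Adj v (P v) := by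
          rw [parentGraph, SimpleGraph.fromEdgeSet_adj]
          refine ⟨⟨v, h, rfl⟩, fun hv' => ?_⟩
          rw [← hv'] at hlt
          exact lt_irrefl _ hlt
        exact hadj.reachable.trans (ih _ (by omega))
  have hconn : (parentGraph P r).Connected :=
    { preconnected := fun u v => (hreach _ u le_rfl).trans (hreach _ v le_rfl).symm
      nonempty := ⟨r⟩ }
  rw [SimpleGraph.isTree_iff_connected_and_card]
  refine ⟨hconn, le_antisymm ?_ hconn.card_vert_le_card_edgeSet_add_one⟩
  have h1 : (parentGraph P r).edgeSet.ncard ≤ ({v | v ≠ r} : Set V).ncard :=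
    (Set.ncard_le_ncard (edgeSet_parentGraph_subset P r)).trans Set.ncard_image_le
  have h2 : ({v | v ≠ r} : Set V).ncard + 1 = Nat.card V := by
    have := Set.ncard_add_ncard_compl ({r} : Set V)
    rw [Set.ncard_singleton, add_comm] at this
    exact this
  rw [Nat.card_coe_set_eq]
  omega

/-- The vertices `v` for which the edge from `v` to `P v` can also be an edge
of the tree with the second parent function. -/
def sharedVertices {V : Type*} (P P' : V → V) (r : V) : Set V :=
  {v | v ≠ r ∧ (P v = P' v ∨ P v ≠ r ∧ P' (P v) = v)}

theorem ncard_edgeSet_inter_parentGraph_le {V : Type*} [Finite V] (P P' : V → V) (r : V) :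
    ((parentGraph P r).edgeSet ∩ (parentGraph P' r).edgeSet).ncard
      ≤ (sharedVertices P P' r).ncard := by
  refine (Set.ncard_le_ncard (t := (fun v => s(v, P v)) '' sharedVertices P P' r) ?_).trans
    Set.ncard_image_le
  rintro e ⟨h, h'⟩
  obtain ⟨v, hv, rfl⟩ := edgeSet_parentGraph_subset P r h
  obtain ⟨w, hw, hvw⟩ := edgeSet_parentGraph_subset P' r h'
  refine ⟨v, ⟨hv, ?_⟩, rfl⟩
  simp only [Sym2.eq_iff] at hvw
  rcases hvw with ⟨rfl, h2⟩ | ⟨rfl, h2⟩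
  · exact Or.inl h2.symm
  · exact Or.inr ⟨hw, h2⟩

theorem IsTreeCode.card_le_A {n d : ℕ} {C : Finset (SimpleGraph (Fin n))}
    (hC : IsTreeCode n d C) : C.card ≤ A n d := by
  classical
  refine le_csSup ⟨Fintype.card (SimpleGraph (Fin n)), ?_⟩ ⟨C, hC, rfl⟩
  rintro m ⟨C', -, rfl⟩
  exact Finset.card_le_univ _

theorem card_le_A_of_parents {ι : Type*} [Fintype ι] {n t M : ℕ} (P : ι → Fin n → Fin n)
    (r : Fin n) (rank : ι → Fin n → ℕ)
    (hrank : ∀ i v, v ≠ r → rank i (P i v) < rank i v)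
    (hM : ∀ i j, i ≠ j → (sharedVertices (P i) (P j) r).ncard ≤ M)
    (hMn : M + 1 < n) (hMt : M < t) : Fintype.card ι ≤ A n (n - t) := by
  classical
  have htree : ∀ i, (parentGraph (P i) r).IsTree := fun i =>
    isTree_parentGraph (P i) r (rank i) (hrank i)
  have hinter : ∀ i j, i ≠ j →
      ((parentGraph (P i) r).edgeSet ∩ (parentGraph (P j) r).edgeSet).ncard ≤ M :=
    fun i j hij => (ncard_edgeSet_inter_parentGraph_le _ _ r).trans (hM i j hij)
  have hinj : Function.Injective fun i => parentGraph (P i) r := by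
    intro i j hij
    by_contra hne
    have h1 := hinter i j hne
    have h2 := ((SimpleGraph.isTree_iff_connected_and_card).1 (htree i)).2
    simp only at hij
    rw [← hij, Set.inter_self] at h1
    rw [Nat.card_coe_set_eq, Nat.card_fin] at h2
    omega
  have hcode : IsTreeCode n (n - t) (Finset.univ.image fun i => parentGraph (P i) r) := by
    refine ⟨?_, ?_⟩
    · simp only [Finset.mem_image, Finset.mem_univ, true_and]
      rintro G ⟨i, rfl⟩
      exact htree i
    · simp only [Finset.mem_image, Finset.mem_univ, true_and]
      rintro G ⟨i, rfl⟩ H ⟨j, rfl⟩ hne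
      have := hinter i j (fun h => hne (by rw [h]))
      rw [treeDist]
      omega
  have := hcode.card_le_A
  rwa [Finset.card_image_of_injective _ hinj, Finset.card_univ] at this

theorem card_le_A_of_parents_equiv {V ι : Type*} [Fintype ι] {n t M : ℕ} (e : V ≃ Fin n)
    (P : ι → V → V) (r : V) (rank : ι → V → ℕ)
    (hrank : ∀ i v, v ≠ r → rank i (P i v) < rank i v)
    (hM : ∀ i j, i ≠ j → (sharedVertices (P i) (P j) r).ncard ≤ M)
    (hMn : M + 1 < n) (hMt : M < t) : Fintype.card ι ≤ A n (n - t) := by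
  refine card_le_A_of_parents (fun i v => e (P i (e.symm v))) (e r) (fun i v => rank i (e.symm v))
    ?_ ?_ hMn hMt
  · intro i v hv
    simpa using hrank i (e.symm v) (fun h => hv (by rw [← h, e.apply_symm_apply]))
  · intro i j hij
    have : sharedVertices (fun v => e (P i (e.symm v))) (fun v => e (P j (e.symm v))) (e r)
        = e '' sharedVertices (P i) (P j) r := by
      ext v
      obtain ⟨u, rfl⟩ := e.surjective v
      rw [e.injective.mem_set_image]
      simp [sharedVertices]
    rw [this, Set.ncard_image_of_injective _ e.injective]
    exact hM i j hij

/-- Parents in a tree on two copies of `Q` and a set `S` of extra leaves: the tree with parent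
function `s` on the first copy has each edge from `x` to `s x` subdivided by the vertex `σ (s x)`
of the second copy. -/
def layeredParent {Q : Type*} {K : ℕ} (S : Finset (Fin K × Q)) (s : Q → Q) (σ : Q ≃ Q) :
    Q ⊕ Q ⊕ S → Q ⊕ Q ⊕ S
  | .inl x => .inr (.inl (σ (s x)))
  | .inr (.inl y) => .inl (σ.symm y)
  | .inr (.inr z) => .inl (σ z.1.2)

/-- A rank decreasing along `layeredParent`, built from a rank `w` on `Q`. -/
def layeredRank {Q : Type*} {K : ℕ} (S : Finset (Fin K × Q)) (w : Q → ℕ) (σ : Q ≃ Q) :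
    Q ⊕ Q ⊕ S → ℕ
  | .inl x => 2 * w x
  | .inr (.inl y) => 2 * w (σ.symm y) + 1
  | .inr (.inr z) => 2 * w (σ z.1.2) + 1

theorem layeredRank_layeredParent_lt {Q : Type*} {K : ℕ} (S : Finset (Fin K × Q)) (s : Q → Q)
    (w : Q → ℕ) (q : Q) (hw : ∀ x, x ≠ q → w (s x) < w x) (σ : Q ≃ Q) (v : Q ⊕ Q ⊕ S)
    (hv : v ≠ .inl q) :
    layeredRank S w σ (layeredParent S s σ v) < layeredRank S w σ v := by
  rcases v with x | y | z
  · have := hw x (fun h => hv (by rw [h]))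
    simp only [layeredParent, layeredRank, Equiv.symm_apply_apply]
    omega
  · simp [layeredParent, layeredRank]
  · simp [layeredParent, layeredRank]

theorem ncard_sharedVertices_layeredParent_le {Q : Type*} [Finite Q] {K B : ℕ}
    (S : Finset (Fin K × Q)) (s : Q → Q) (q : Q) (σ σ' : Q ≃ Q)
    (hagree : {x | σ x = σ' x}.ncard ≤ B)
    (hpre : {x | x ≠ q ∧ σ (s x) = σ' (s x)}.ncard ≤ 2 * B)
    (hshift : {x | x ≠ q ∧ σ x = σ' (s x)}.ncard ≤ 2 * B)
    (hshift' : {x | x ≠ q ∧ σ' x = σ (s x)}.ncard ≤ 2 * B) :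
    (sharedVertices (layeredParent S s σ) (layeredParent S s σ') (.inl q)).ncard
      ≤ (7 + K) * B := by
  have hsub : sharedVertices (layeredParent S s σ) (layeredParent S s σ') (.inl q) ⊆
      (Sum.inl '' ({x | x ≠ q ∧ σ (s x) = σ' (s x)} ∪ {x | x ≠ q ∧ σ' x = σ (s x)})) ∪
      (((fun x => .inr (.inl (σ x))) '' ({x | σ x = σ' x} ∪ {x | x ≠ q ∧ σ x = σ' (s x)})) ∪
      ((fun z : S => .inr (.inr z)) '' {z : S | σ z.1.2 = σ' z.1.2})) := by
    rintro (x | y | z) ⟨hv, h⟩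
    · left
      refine ⟨x, ?_, rfl⟩
      have hx : x ≠ q := fun h => hv (by rw [h])
      simp only [layeredParent, Sum.inr.injEq, Sum.inl.injEq, Equiv.symm_apply_eq] at h
      rcases h with h | h
      · exact Or.inl ⟨hx, h⟩
      · exact Or.inr ⟨hx, h.2.symm⟩
    · right; left
      refine ⟨σ.symm y, ?_, by simp⟩
      simp only [layeredParent, Sum.inr.injEq, Sum.inl.injEq, ne_eq] at h
      rcases h with h | h
      · left
        rw [Set.mem_ofPred_eq, Equiv.apply_symm_apply, h, Equiv.apply_symm_apply]
      · right
        exact ⟨h.1, by rw [Equiv.apply_symm_apply, h.2]⟩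
    · right; right
      refine ⟨z, ?_, rfl⟩
      simpa [layeredParent] using h
  have hleaf : {z : S | σ z.1.2 = σ' z.1.2}.ncard ≤ K * B := by
    calc {z : S | σ z.1.2 = σ' z.1.2}.ncard
        = (Subtype.val '' {z : S | σ z.1.2 = σ' z.1.2}).ncard :=
          (Set.ncard_image_of_injective _ Subtype.val_injective).symm
      _ ≤ ((Set.univ : Set (Fin K)) ×ˢ {x | σ x = σ' x}).ncard := by
          refine Set.ncard_le_ncard ?_
          rintro _ ⟨z, hz, rfl⟩
          exact ⟨trivial, hz⟩
      _ = K * {x | σ x = σ' x}.ncard := by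
          rw [Set.ncard_prod, Set.ncard_univ, Nat.card_fin]
      _ ≤ K * B := Nat.mul_le_mul_left _ hagree
  have h0 := Set.ncard_le_ncard hsub
  have h1 := Set.ncard_union_le
    ((Sum.inl : Q → Q ⊕ Q ⊕ S) ''
      ({x | x ≠ q ∧ σ (s x) = σ' (s x)} ∪ {x | x ≠ q ∧ σ' x = σ (s x)}))
    (((fun x => .inr (.inl (σ x))) '' ({x | σ x = σ' x} ∪ {x | x ≠ q ∧ σ x = σ' (s x)})) ∪
      ((fun z : S => .inr (.inr z)) '' {z : S | σ z.1.2 = σ' z.1.2}))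
  have h2 := Set.ncard_union_le
    ((fun x => (.inr (.inl (σ x)) : Q ⊕ Q ⊕ S)) ''
      ({x | σ x = σ' x} ∪ {x | x ≠ q ∧ σ x = σ' (s x)}))
    ((fun z : S => .inr (.inr z)) '' {z : S | σ z.1.2 = σ' z.1.2})
  have h3 := Set.ncard_image_le (f := (Sum.inl : Q → Q ⊕ Q ⊕ S))
    (s := {x | x ≠ q ∧ σ (s x) = σ' (s x)} ∪ {x | x ≠ q ∧ σ' x = σ (s x)}) (Set.toFinite _)
  have h4 := Set.ncard_image_le (f := (fun x => (.inr (.inl (σ x)) : Q ⊕ Q ⊕ S)))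
    (s := {x | σ x = σ' x} ∪ {x | x ≠ q ∧ σ x = σ' (s x)}) (Set.toFinite _)
  have h5 := Set.ncard_image_le (f := (fun z : S => (.inr (.inr z) : Q ⊕ Q ⊕ S)))
    (s := {z : S | σ z.1.2 = σ' z.1.2}) (Set.toFinite _)
  have h6 := Set.ncard_union_le {x | x ≠ q ∧ σ (s x) = σ' (s x)} {x | x ≠ q ∧ σ' x = σ (s x)}
  have h7 := Set.ncard_union_le {x | σ x = σ' x} {x | x ≠ q ∧ σ x = σ' (s x)}
  rw [add_mul]
  omega

/-- The two-round Feistel permutation of `F × F` with round function `f`. -/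
def feistel {F : Type*} [AddCommGroup F] (f : F → F) : F × F ≃ F × F where
  toFun x := (x.1 + f (x.2 + f x.1), x.2 + f x.1)
  invFun y := (y.1 - f y.2, y.2 - f (y.1 - f y.2))
  left_inv x := by simp
  right_inv y := by simp

theorem ncard_feistel_agree_le {F : Type*} [AddCommGroup F] [Finite F] {D : ℕ} (f f' : F → F)
    (h : {v | f v = f' v}.ncard ≤ D) :
    {x | feistel f x = feistel f' x}.ncard ≤ D * D := by
  calc {x | feistel f x = feistel f' x}.ncard
      ≤ ({v | f v = f' v} ×ˢ {v | f v = f' v}).ncard := by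
        refine Set.ncard_le_ncard_of_injOn (fun x => (x.1, x.2 + f x.1)) ?_ ?_
        · rintro ⟨a, b⟩ hx
          simp only [feistel, Set.mem_ofPred_eq, Equiv.coe_fn_mk, Prod.mk.injEq] at hx
          have ha : f a = f' a := add_left_cancel hx.2
          refine ⟨ha, ?_⟩
          have := hx.1
          rw [← ha] at this
          exact add_left_cancel this
        · rintro ⟨a, b⟩ - ⟨a', b'⟩ - hx
          simp only [Prod.mk.injEq] at hx
          obtain ⟨rfl, hb⟩ := hx
          rw [add_right_cancel hb]
    _ ≤ D * D := by
        rw [Set.ncard_prod]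
        exact Nat.mul_le_mul h h

/-- The parent function of a comb-shaped tree on `F × F` with root `0`. -/
def combParent {F : Type*} [Ring F] [DecidableEq F] (x : F × F) : F × F :=
  if x.2 = 0 then (x.1 - 1, 0) else (x.1, x.2 - 1)

theorem ncard_combParent_preimage_le {F : Type*} [Ring F] [DecidableEq F] [Finite F]
    (T : Set (F × F)) : {x | combParent x ∈ T}.ncard ≤ 2 * T.ncard := by
  have hsub : {x | combParent x ∈ T} ⊆ (fun x => x + (1, 0)) '' T ∪ (fun x => x + (0, 1)) '' T := by
    rintro ⟨a, b⟩ h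
    simp only [combParent, Set.mem_ofPred_eq] at h
    split_ifs at h with hb
    · exact Or.inl ⟨_, h, by simp [hb]⟩
    · exact Or.inr ⟨_, h, by simp⟩
  have h0 := Set.ncard_le_ncard hsub
  have h1 := Set.ncard_union_le ((fun x : F × F => x + (1, 0)) '' T) ((fun x => x + (0, 1)) '' T)
  have h2 := Set.ncard_image_le (f := fun x : F × F => x + (1, 0)) (s := T) (Set.toFinite _)
  have h3 := Set.ncard_image_le (f := fun x : F × F => x + (0, 1)) (s := T) (Set.toFinite _)
  omega

theorem ncard_feistel_combParent_le {F : Type*} [Ring F] [DecidableEq F] [Finite F] {D : ℕ}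
    (f f' : F → F) (h : ∀ c, {v | f v - f' v = c}.ncard ≤ D) (hf : ∀ c, {v | f v = c}.ncard ≤ D) :
    {x | feistel f x = feistel f' (combParent x)}.ncard ≤ 2 * (D * D) := by
  classical
  have := Fintype.ofFinite F
  have hsub : {x | feistel f x = feistel f' (combParent x)} ⊆
      {x : F × F | x.2 = 0 ∧ f (f x.1) - f' (f x.1) = -1} ∪
      {x : F × F | f x.1 - f' x.1 = -1 ∧ f (x.2 + f x.1) - f' (x.2 + f x.1) = 0} := by
    rintro ⟨a, b⟩ hx
    simp only [combParent, Set.mem_ofPred_eq] at hx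
    split_ifs at hx with hb
    · left
      subst hb
      simp only [feistel, Equiv.coe_fn_mk, Prod.mk.injEq, zero_add] at hx
      refine ⟨rfl, ?_⟩
      have h1 := hx.1
      rw [← hx.2, sub_add_eq_add_sub, add_sub_assoc] at h1
      have h2 := add_left_cancel h1
      simp only
      rw [h2]
      abel
    · right
      simp only [feistel, Equiv.coe_fn_mk, Prod.mk.injEq] at hx
      have h1 := hx.1
      rw [← hx.2] at h1
      refine ⟨?_, sub_eq_zero.2 (add_left_cancel h1)⟩
      have h2 := hx.2
      rw [sub_add_eq_add_sub, add_sub_assoc] at h2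
      have h3 := add_left_cancel h2
      simp only
      rw [h3]
      abel
  have hA : {x : F × F | x.2 = 0 ∧ f (f x.1) - f' (f x.1) = -1}.ncard ≤ D * D := by
    have hR := h (-1)
    rw [Set.ncard_eq_toFinset_card'] at hR
    have hb : (({v | f v - f' v = -1} : Set F).toFinset.biUnion
        fun v => ({a | f a = v} : Set F).toFinset).card ≤ D * D := by
      refine (Finset.card_biUnion_le_card_mul _ _ D fun v _ => ?_).trans
        (Nat.mul_le_mul_right _ hR)
      rw [← Set.ncard_eq_toFinset_card']
      exact hf v
    rw [← Set.ncard_coe_finset] at hb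
    refine le_trans (Set.ncard_le_ncard_of_injOn Prod.fst ?_ ?_) hb
    · rintro ⟨a, b⟩ ⟨-, hx⟩
      simpa using hx
    · rintro ⟨a, b⟩ ⟨hb, -⟩ ⟨a', b'⟩ ⟨hb', -⟩ hx
      simp only at hb hb' hx
      rw [hb, hb', hx]
  have hB : {x : F × F | f x.1 - f' x.1 = -1 ∧ f (x.2 + f x.1) - f' (x.2 + f x.1) = 0}.ncard
      ≤ D * D := by
    calc _ ≤ ({v | f v - f' v = -1} ×ˢ {v | f v - f' v = 0}).ncard := by
          refine Set.ncard_le_ncard_of_injOn (fun x => (x.1, x.2 + f x.1)) (fun x hx => hx) ?_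
          rintro ⟨a, b⟩ - ⟨a', b'⟩ - hx
          simp only [Prod.mk.injEq] at hx
          obtain ⟨rfl, hb⟩ := hx
          rw [add_right_cancel hb]
      _ ≤ D * D := by
          rw [Set.ncard_prod]
          exact Nat.mul_le_mul (h _) (h _)
  have h0 := Set.ncard_le_ncard hsub
  have h1 := Set.ncard_union_le {x : F × F | x.2 = 0 ∧ f (f x.1) - f' (f x.1) = -1}
    {x : F × F | f x.1 - f' x.1 = -1 ∧ f (x.2 + f x.1) - f' (x.2 + f x.1) = 0}
  omega

theorem val_combParent_lt {p : ℕ} [Fact p.Prime] (x : ZMod p × ZMod p) (hx : x ≠ 0) :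
    (combParent x).1.val + (combParent x).2.val < x.1.val + x.2.val := by
  have hval : ∀ a : ZMod p, a ≠ 0 → (a - 1).val < a.val := by
    intro a ha
    have h1 : (1 : ZMod p).val = 1 := ZMod.val_one p
    have h2 : 0 < a.val := Nat.pos_of_ne_zero ((ZMod.val_ne_zero a).2 ha)
    rw [ZMod.val_sub (by omega), h1]
    omega
  obtain ⟨a, b⟩ := x
  unfold combParent
  split_ifs with hb
  · simp only at hb
    subst hb
    have := hval a (fun h => hx (by rw [h]; rfl))
    simpa using this
  · have := hval b hb
    simpa using this

open Polynomial in
theorem ncard_mul_eval_eq_le {F : Type*} [Field F] {m : ℕ} (h : F[X]) (h0 : h ≠ 0)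
    (hm : h.natDegree ≤ m) (c : F) : {a | a * h.eval a = c}.ncard ≤ m + 1 := by
  classical
  have hdeg : (X * h - C c).natDegree = h.natDegree + 1 := by
    rw [natDegree_sub_C, natDegree_X_mul h0]
  have hne : X * h - C c ≠ 0 := by
    intro hz
    rw [hz] at hdeg
    simp at hdeg
  calc {a | a * h.eval a = c}.ncard
      ≤ ((X * h - C c).roots.toFinset : Set F).ncard := by
        refine Set.ncard_le_ncard ?_ (Finset.finite_toSet _)
        intro a ha
        simp only [Set.mem_ofPred_eq] at ha
        simp [hne, ha]
    _ ≤ m + 1 := by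
        rw [Set.ncard_coe_finset]
        exact (Multiset.toFinset_card_le _).trans ((card_roots' _).trans (by omega))

open Polynomial in
theorem pow_le_A_of_prime {n m p t : ℕ} (hp : p.Prime) (hpn : 2 * p ^ 2 ≤ n) (hnp : n ≤ 8 * p ^ 2)
    (hn : 15 * ((m + 1) * (m + 1)) + 1 < n) (ht : 15 * ((m + 1) * (m + 1)) < t) :
    p ^ m ≤ A n (n - t) := by
  classical
  have : Fact p.Prime := ⟨hp⟩
  obtain ⟨S, -, hS⟩ := Finset.exists_subset_card_eq
    (s := (Finset.univ : Finset (Fin 8 × (ZMod p × ZMod p)))) (n := n - 2 * p ^ 2) (by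
      rw [Finset.card_univ]
      simp only [Fintype.card_prod, Fintype.card_fin, ZMod.card, ← pow_two]
      omega)
  have hcard : Fintype.card ((ZMod p × ZMod p) ⊕ (ZMod p × ZMod p) ⊕ S) = n := by
    simp only [Fintype.card_sum, Fintype.card_prod, ZMod.card, Fintype.card_coe, hS, ← pow_two]
    omega
  have e := Fintype.equivFinOfCardEq hcard
  let g : (Fin m → ZMod p) → (ZMod p)[X] := fun c =>
    ((degreeLTEquiv (ZMod p) m).symm c : (ZMod p)[X])
  have hgdeg : ∀ c, (g c).degree < m := fun c =>
    mem_degreeLT.1 ((degreeLTEquiv (ZMod p) m).symm c).2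
  have hginj : Function.Injective g := fun c c' hc =>
    (degreeLTEquiv (ZMod p) m).symm.injective (Subtype.ext hc)
  let f : (Fin m → ZMod p) → ZMod p → ZMod p := fun c a => a * (X ^ m + g c).eval a
  have hf : ∀ c b, {v | f c v = b}.ncard ≤ m + 1 := fun c b =>
    ncard_mul_eval_eq_le _ (monic_X_pow_add (hgdeg c)).ne_zero
      (natDegree_le_of_degree_le
        ((degree_add_le _ _).trans (max_le (degree_X_pow_le m) (hgdeg c).le))) b
  have hff : ∀ c c', c ≠ c' → ∀ b, {v | f c v - f c' v = b}.ncard ≤ m + 1 := by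
    intro c c' hc b
    have := ncard_mul_eval_eq_le (g c - g c') (sub_ne_zero.2 (hginj.ne hc)) (m := m)
      (natDegree_le_of_degree_le
        ((degree_sub_le _ _).trans (max_le (hgdeg c).le (hgdeg c').le))) b
    convert this using 5
    simp only [f, eval_add, eval_sub]
    ring
  have hagree : ∀ c c', c ≠ c' →
      {x | feistel (f c) x = feistel (f c') x}.ncard ≤ (m + 1) * (m + 1) := fun c c' hc =>
    ncard_feistel_agree_le _ _ (by simpa only [sub_eq_zero] using hff c c' hc 0)
  have hshift : ∀ c c', c ≠ c' →
      {x | x ≠ 0 ∧ feistel (f c) x = feistel (f c') (combParent x)}.ncard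
        ≤ 2 * ((m + 1) * (m + 1)) := fun c c' hc =>
    (Set.ncard_le_ncard fun x hx => hx.2).trans
      (ncard_feistel_combParent_le _ _ (hff c c' hc) (hf c))
  have hmain := card_le_A_of_parents_equiv e (fun c => layeredParent S combParent (feistel (f c)))
    (.inl 0) (fun c => layeredRank S (fun x => x.1.val + x.2.val) (feistel (f c)))
    (fun c => layeredRank_layeredParent_lt S combParent _ 0 val_combParent_lt (feistel (f c)))
    (fun c c' hc => ncard_sharedVertices_layeredParent_le S combParent 0 _ _ (hagree c c' hc)
      ((Set.ncard_le_ncard fun x hx => hx.2).trans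
        ((ncard_combParent_preimage_le {x | feistel (f c) x = feistel (f c') x}).trans
          (Nat.mul_le_mul_left _ (hagree c c' hc))))
      (hshift c c' hc) (hshift c' c hc.symm)) hn ht
  simpa using hmain

theorem exists_prime_sq_between {n : ℕ} (hn : 8 ≤ n) :
    ∃ p : ℕ, p.Prime ∧ 2 * p ^ 2 ≤ n ∧ n ≤ 8 * p ^ 2 := by
  have h0 : Nat.sqrt (n / 8) ≠ 0 := by
    have : 0 < Nat.sqrt (n / 8) := Nat.sqrt_pos.2 (by omega)
    omega
  obtain ⟨p, hp, hlt, hle⟩ := Nat.exists_prime_lt_and_le_two_mul _ h0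
  refine ⟨p, hp, ?_, ?_⟩
  · have h1 : Nat.sqrt (n / 8) ^ 2 ≤ n / 8 := Nat.sqrt_le' _
    have h2 : p ^ 2 ≤ (2 * Nat.sqrt (n / 8)) ^ 2 := Nat.pow_le_pow_left hle 2
    rw [mul_pow] at h2
    omega
  · have h1 : n / 8 < p ^ 2 := Nat.sqrt_lt'.1 hlt
    omega

open Filter in
theorem tendsto_mul_log_div_log_log (a : ℝ) (ha : 0 < a) :
    Tendsto (fun n : ℕ => a * Real.log n / Real.log (Real.log n)) atTop atTop := by
  have h1 : Tendsto (fun x : ℝ => x / Real.log x) atTop atTop := by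
    have h : Tendsto (fun x : ℝ => Real.log x / x) atTop (nhdsWithin 0 (Set.Ioi 0)) := by
      refine tendsto_nhdsWithin_iff.2 ⟨Real.isLittleO_log_id_atTop.tendsto_div_nhds_zero, ?_⟩
      filter_upwards [eventually_gt_atTop 1] with x hx
      exact div_pos (Real.log_pos hx) (by linarith)
    refine h.inv_tendsto_nhdsGT_zero.congr fun x => ?_
    simp
  have h2 := (h1.comp (Real.tendsto_log_atTop.comp tendsto_natCast_atTop_atTop)).const_mul_atTop ha
  refine h2.congr fun n => ?_
  simp [mul_div_assoc]

theorem stmt17 (k : ℕ) (hk : 1 ≤ k) :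
    ∃ c : ℝ, 0 < c ∧ ∃ N : ℕ, ∀ n : ℕ, N ≤ n →
      c * (n : ℝ) ^ k ≤
        (A n (n - ⌈((k : ℝ) + 1) * Real.log n / Real.log (Real.log n)⌉₊) : ℝ) := by
  set M : ℕ := 15 * ((2 * k + 1) * (2 * k + 1))
  obtain ⟨N, hN⟩ := Filter.eventually_atTop.1
    ((tendsto_mul_log_div_log_log ((k : ℝ) + 1) (by positivity)).eventually_gt_atTop (M : ℝ))
  refine ⟨(1 / 8) ^ k, by positivity, max N (M + 8), fun n hn => ?_⟩
  have hnN : N ≤ n := (le_max_left _ _).trans hn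
  have hnM : M + 8 ≤ n := (le_max_right _ _).trans hn
  obtain ⟨p, hp, hpn, hnp⟩ := exists_prime_sq_between (n := n) (by omega)
  have hA := pow_le_A_of_prime (m := 2 * k) hp hpn hnp (by omega) (Nat.lt_ceil.2 (hN n hnN))
  have hnp' : (n : ℝ) ≤ 8 * (p : ℝ) ^ 2 := by exact_mod_cast hnp
  calc (1 / 8 : ℝ) ^ k * (n : ℝ) ^ k = ((n : ℝ) / 8) ^ k := by rw [← mul_pow]; ring
    _ ≤ ((p : ℝ) ^ 2) ^ k := by gcongr; linarith
    _ = ((p ^ (2 * k) : ℕ) : ℝ) := by push_cast; rw [pow_mul]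
    _ ≤ _ := by exact_mod_cast hA
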